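/- Assume char K ≠ 2 and X is a connected locally finite poset satisfying conditions (M) and (D). Let λ be an involution on X with no fixed points, and let X = X₁ ∪ X₂ be a partition such that λ maps X₁ into X₂ and X₂ into X₁, and such that y ≤ x with x ∈ X₁ implies y ∈ X₁, and x ≤ y with x ∈ X₂ implies y ∈ X₂. Let w ∈ A be the diagonal element with w(x,x) = 1 for x ∈ X₁, w(x,x) = −1 for x ∈ X₂, and w(x,y) = 0 for x ≠ y, and set σ_λ = Ψ_w ∘ ρ_λ and σ̃_λ(f,i) = (σ_λ(f), σ_λ(i)). Then for every involution Φ on D(X,K) of the form Φ = Ψ_θ ∘ ρ̃_λ ∘ (k̃δ), with θ a unit of D(X,K) and k ∈ {−1,1}, there exists an inner automorphism Ψ of D(X,K) such that Φ ∘ Ψ = Ψ ∘ (ρ̃_λ ∘ (k̃δ)) or Φ ∘ Ψ = Ψ ∘ (σ̃_λ ∘ (k̃δ)). -/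

import Mathlib

open TrivSqZeroExt

variable (K X : Type*) [Field K] [PartialOrder X] [LocallyFiniteOrder X] [DecidableEq X]

/-- The anti-automorphism `ρ_λ` of the incidence algebra induced by an order
anti-automorphism `lam` of `X`: `ρ_λ(f)(x,y) = f(λ(y), λ(x))`. -/
def rhoLam (lam : X → X) (hlam : ∀ x y : X, x ≤ y ↔ lam y ≤ lam x)
    (f : IncidenceAlgebra K X) : IncidenceAlgebra K X :=
  ⟨fun x y => f (lam y) (lam x), fun x y hxy =>
    IncidenceAlgebra.apply_eq_zero_of_not_le (fun h => hxy ((hlam x y).mpr h)) f⟩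

/-- The anti-automorphism `ρ̃_λ` of `D(X,K)`: `(f,i) ↦ (ρ_λ(f), ρ_λ(i))`. -/
def rhoTilde (lam : X → X) (hlam : ∀ x y : X, x ≤ y ↔ lam y ≤ lam x)
    (d : TrivSqZeroExt (IncidenceAlgebra K X) (IncidenceAlgebra K X)) :
    TrivSqZeroExt (IncidenceAlgebra K X) (IncidenceAlgebra K X) :=
  inl (rhoLam K X lam hlam d.fst) + inr (rhoLam K X lam hlam d.snd)

/-- The automorphism `k̃δ` of `D(X,K)`: `(f,i) ↦ (f, k·i)`. -/
def kTilde (k : K) (d : TrivSqZeroExt (IncidenceAlgebra K X) (IncidenceAlgebra K X)) :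
    TrivSqZeroExt (IncidenceAlgebra K X) (IncidenceAlgebra K X) :=
  inl d.fst + inr (k • d.snd)

/-- Condition (M): every multiplicative automorphism of `I(X,K)` is inner. -/
def CondM : Prop :=
  ∀ σ : X → X → K, (∀ x y : X, x ≤ y → σ x y ≠ 0) →
    (∀ x y z : X, x ≤ y → y ≤ z → σ x y * σ y z = σ x z) →
    ∃ u : (IncidenceAlgebra K X)ˣ, ∀ (f : IncidenceAlgebra K X) (x y : X), x ≤ y →
      (↑u * f * ↑u⁻¹ : IncidenceAlgebra K X) x y = σ x y * f x y

/-- Condition (D): every `K`-linear derivation of `I(X,K)` is inner. -/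
def CondD : Prop :=
  ∀ Der : IncidenceAlgebra K X → IncidenceAlgebra K X,
    (∀ f g, Der (f + g) = Der f + Der g) →
    (∀ (k : K) (f : IncidenceAlgebra K X), Der (k • f) = k • Der f) →
    (∀ f g, Der (f * g) = Der f * g + f * Der g) →
    ∃ i : IncidenceAlgebra K X, ∀ f, Der f = f * i - i * f

/-- Connectedness of the poset `X`. -/
def PosetConnected : Prop :=
  ∀ x y : X, Relation.ReflTransGen (fun a b : X => a ≤ b ∨ b ≤ a) x y

/-- The diagonal element `w` with `w(x,x) = 1` for `x ∈ X₁`, `w(x,x) = -1` for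
`x ∉ X₁` (i.e. `x ∈ X₂`), and `w(x,y) = 0` for `x ≠ y`. -/
noncomputable def wElem (K X : Type*) [Field K] [PartialOrder X] [LocallyFiniteOrder X]
    [DecidableEq X] (X₁ : Set X) : IncidenceAlgebra K X :=
  open Classical in
  ⟨fun x y => if x = y then (if x ∈ X₁ then (1 : K) else -1) else 0,
    fun a b hab => if_neg (fun h => hab (le_of_eq h))⟩

/-- The involution `σ_λ = Ψ_w ∘ ρ_λ` on `I(X,K)` (here `w⁻¹` is `Ring.inverse w`,
and in fact `w⁻¹ = w`). -/
noncomputable def sigmaLam (K X : Type*) [Field K] [PartialOrder X] [LocallyFiniteOrder X]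
    [DecidableEq X] (X₁ : Set X) (lam : X → X)
    (hlam : ∀ x y : X, x ≤ y ↔ lam y ≤ lam x) (f : IncidenceAlgebra K X) :
    IncidenceAlgebra K X :=
  wElem K X X₁ * rhoLam K X lam hlam f * Ring.inverse (wElem K X X₁)

/-- The involution `σ̃_λ : (f,i) ↦ (σ_λ(f), σ_λ(i))` on `D(X,K)`. -/
noncomputable def sigmaTilde (K X : Type*) [Field K] [PartialOrder X] [LocallyFiniteOrder X]
    [DecidableEq X] (X₁ : Set X) (lam : X → X)
    (hlam : ∀ x y : X, x ≤ y ↔ lam y ≤ lam x)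
    (d : TrivSqZeroExt (IncidenceAlgebra K X) (IncidenceAlgebra K X)) :
    TrivSqZeroExt (IncidenceAlgebra K X) (IncidenceAlgebra K X) :=
  inl (sigmaLam K X X₁ lam hlam d.fst) + inr (sigmaLam K X X₁ lam hlam d.snd)

theorem exists_unit_mul_mul_involution {B : Type*} [Ring B] (R : B → B)
    (hadd : ∀ x y, R (x + y) = R x + R y) (hmul : ∀ x y, R (x * y) = R y * R x)
    (hone : R 1 = 1) {e η a : B} (he : e * e = e) (hRe : R e = 1 - e)
    (hcorner : ∀ x, e * (x * e) = x * e) (hη : η + η = 1) (ha : a = 1 ∨ a = -1)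
    (t : Bˣ) (ht : R t = a * t) :
    ∃ g : Bˣ, ↑g * (e + a * (1 - e)) * R g = t := by
  have hsub (x y) : R (x - y) = R x - R y := by
    rw [eq_sub_iff_add_eq, ← hadd, sub_add_cancel]
  have hη2 (x) : η * x + η * x = x := by rw [← add_mul, hη, one_mul]
  have hηc (x) : x * η = η * x := by
    have h1 : x * η = (η + η) * (x * η) := by rw [hη, one_mul]
    rw [h1, add_mul, ← mul_add, ← mul_add, hη, mul_one]
  have hηc' (x y) : x * (η * y) = η * (x * y) := by rw [← mul_assoc, hηc, mul_assoc]
  have hRη : R η = η := by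
    have h1 : R η + R η = 1 := by rw [← hadd, hη, hone]
    calc R η = (η + η) * R η := by rw [hη, one_mul]
      _ = η := by rw [add_mul, ← mul_add, h1, mul_one]
  obtain ⟨t, t', htt, htt'⟩ := t
  simp only at ht ⊢
  have ht' : R t' = a * t' := by
    have h1 : R t' * (a * t) = 1 := by rw [← ht, ← hmul, htt, hone]
    have h2 : a * t * (a * t') = 1 := by rcases ha with rfl | rfl <;> simp [htt]
    exact left_inv_eq_right_inv h1 h2
  have he2 (x) : e * (e * x) = e * x := by rw [← mul_assoc, he]
  have hc2 (x y) : e * (x * (e * y)) = x * (e * y) := by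
    rw [← mul_assoc x, ← mul_assoc, hcorner]
  have hc3 (x y) : e * (x * (y * e)) = x * (y * e) := by
    rw [← mul_assoc x, hcorner]
  have hc4 (x y z) : e * (x * (y * (e * z))) = x * (y * (e * z)) := by
    simpa only [mul_assoc] using hc2 (x * y) z
  have htt2 (x) : t * (t' * x) = x := by rw [← mul_assoc, htt, one_mul]
  have htt2' (x) : t' * (t * x) = x := by rw [← mul_assoc, htt', one_mul]
  refine ⟨⟨t * e + 1 - e + η * (e - t * e * t'), t' * e + 1 - e - η * (t' * (e - t * e * t')),
    ?_, ?_⟩, ?_⟩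
  · simp only [mul_add, add_mul, mul_sub, sub_mul, mul_one, one_mul, mul_assoc, he, he2,
      htt2, htt2', hηc', hcorner, hc2, hc3]
    abel
  · simp only [mul_add, add_mul, mul_sub, sub_mul, mul_one, one_mul, mul_assoc, he, he2,
      htt2', hηc', hcorner, hc2]
    abel
  · simp only [hadd, hsub, hmul, hone, hRe, ht, ht', hRη]
    rcases ha with rfl | rfl
    · simp only [mul_add, add_mul, mul_sub, sub_mul, mul_one, one_mul, mul_assoc, he, he2, htt',
        htt2, hηc', hcorner, hc2, hc4, hηc]
      linear_combination (norm := abel) hη2 (e * t) - hη2 (t * e)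
    · simp only [mul_add, add_mul, mul_sub, sub_mul, mul_one, one_mul, mul_assoc, he, he2, htt',
        htt2, hηc', hcorner, hc2, hc4, hηc, neg_mul, mul_neg]
      linear_combination (norm := abel) hη2 (e * t) - hη2 (t * e)

theorem exists_unit_conj_involution {B : Type*} [Ring B] (R : B → B)
    (hadd : ∀ x y, R (x + y) = R x + R y) (hmul : ∀ x y, R (x * y) = R y * R x)
    (hone : R 1 = 1) {e η a : B} (he : e * e = e) (hRe : R e = 1 - e)
    (hcorner : ∀ x, e * (x * e) = x * e) (hη : η + η = 1) (ha : a = 1 ∨ a = -1)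
    (θ z : Bˣ) (hz : ∀ x : B, z * x = x * z) (hθ : R (z * θ) = a * (z * θ)) :
    ∃ g : Bˣ, ∀ d, θ * R (g * d * ↑g⁻¹) * ↑θ⁻¹ =
      g * ((e + a * (1 - e)) * R d * (e + a * (1 - e))) * ↑g⁻¹ := by
  obtain ⟨g, hg⟩ := exists_unit_mul_mul_involution R hadd hmul hone he hRe hcorner hη ha
    (z * θ) (by simpa using hθ)
  refine ⟨g, fun d => ?_⟩
  set w := e + a * (1 - e) with hw
  have hww : w * w = 1 := by
    rcases ha with rfl | rfl <;>
    · simp only [hw, mul_add, add_mul, mul_sub, sub_mul, mul_one, one_mul, neg_mul, mul_neg, he]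
      abel
  have hRg : R g * R ↑g⁻¹ = 1 := by rw [← hmul, Units.inv_mul, hone]
  have h1 : θ * R ↑g⁻¹ = ↑z⁻¹ * (g * w) := by
    rw [← mul_one (g * w : B), ← hRg, ← mul_assoc (g * w : B), hg]
    simp [mul_assoc]
  have h2 : R g * ↑θ⁻¹ = w * (↑g⁻¹ * z) := by
    have : R g = w * (↑g⁻¹ * (z * θ)) := by
      rw [Units.val_mul] at hg
      rw [← hg, mul_assoc, Units.inv_mul_cancel_left, ← mul_assoc, hww, one_mul]
    rw [this]
    simp [mul_assoc]
  calc θ * R (g * d * ↑g⁻¹) * ↑θ⁻¹ = (θ * R ↑g⁻¹) * R d * (R g * ↑θ⁻¹) := by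
        simp only [hmul, mul_assoc]
    _ = ↑z⁻¹ * ((g * (w * R d * w) * ↑g⁻¹) * z) := by rw [h1, h2]; simp only [mul_assoc]
    _ = _ := by rw [← hz, Units.inv_mul_cancel_left]

theorem central_of_involution {B : Type*} [Ring B] (R : B → B)
    (hmul : ∀ x y, R (x * y) = R y * R x) (hone : R 1 = 1) (hinv : ∀ x, R (R x) = x) (θ : Bˣ)
    (h : ∀ d, θ * R (θ * R d * ↑θ⁻¹) * ↑θ⁻¹ = d) :
    ∃ c : B, (∀ x, c * x = x * c) ∧ θ = c * R θ ∧ c * R c = 1 := by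
  have h1 : R ↑θ⁻¹ * R θ = 1 := by rw [← hmul, Units.mul_inv, hone]
  have h2 : R θ * R ↑θ⁻¹ = 1 := by rw [← hmul, Units.inv_mul, hone]
  have hc (x) : θ * R ↑θ⁻¹ * x = x * (θ * R ↑θ⁻¹) := by
    conv_rhs => rw [← h x]
    simp only [hmul, hinv, mul_assoc, Units.inv_mul_cancel_left, h2, mul_one]
  refine ⟨θ * R ↑θ⁻¹, hc, by rw [mul_assoc, h1, mul_one], ?_⟩
  rw [hmul, hinv, ← mul_assoc, hc, Units.inv_mul_cancel_left, h1]

section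

variable {K X}

theorem IncidenceAlgebra.exists_smul_one_of_central [Nonempty X] (hconn : PosetConnected X)
    (f : IncidenceAlgebra K X) (hf : ∀ g, f * g = g * f) : ∃ a : K, f = a • 1 := by
  have key (x y : X) (hxy : x ≤ y) : f x x = f y y ∧ (x ≠ y → f x y = 0) := by
    let E (u v : X) (h : u ≤ v) : IncidenceAlgebra K X :=
      ⟨fun s t => if s = u ∧ t = v then 1 else 0, fun s t hst =>
        if_neg fun h' => hst (by rwa [h'.1, h'.2])⟩
    have hE (u v h s t) : E u v h s t = if s = u ∧ t = v then 1 else 0 := rfl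
    constructor
    · have := congrArg (fun g : IncidenceAlgebra K X => g x y) (hf (E x y hxy))
      simpa [IncidenceAlgebra.mul_apply, hE, hxy] using this
    · intro hne
      have := congrArg (fun g : IncidenceAlgebra K X => g x y) (hf (E x x le_rfl))
      simpa [IncidenceAlgebra.mul_apply, hE, hxy, hne.symm] using this.symm
  obtain ⟨x₀⟩ := ‹Nonempty X›
  have hdiag (x : X) : f x₀ x₀ = f x x := by
    induction hconn x₀ x with
    | refl => rfl
    | tail _ h ih => exact ih.trans (h.elim (fun h => (key _ _ h).1) fun h => (key _ _ h).1.symm)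
  refine ⟨f x₀ x₀, IncidenceAlgebra.ext fun x y hxy => ?_⟩
  rcases eq_or_ne x y with rfl | hne
  · simp [hdiag x]
  · simp [hne, (key x y hxy).2 hne]

variable {lam : X → X} (hlam : ∀ x y : X, x ≤ y ↔ lam y ≤ lam x)

theorem rhoLam_apply (f : IncidenceAlgebra K X) (x y : X) :
    rhoLam K X lam hlam f x y = f (lam y) (lam x) := rfl

theorem rhoLam_add (f g : IncidenceAlgebra K X) :
    rhoLam K X lam hlam (f + g) = rhoLam K X lam hlam f + rhoLam K X lam hlam g := rfl

theorem rhoLam_smul (k : K) (f : IncidenceAlgebra K X) :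
    rhoLam K X lam hlam (k • f) = k • rhoLam K X lam hlam f := rfl

theorem rhoLam_zero : rhoLam K X lam hlam 0 = 0 := rfl

theorem rhoLam_rhoLam (hinvo : ∀ x : X, lam (lam x) = x) (f : IncidenceAlgebra K X) :
    rhoLam K X lam hlam (rhoLam K X lam hlam f) = f := by
  ext x y
  simp [rhoLam_apply, hinvo]

theorem rhoLam_one (hinvo : ∀ x : X, lam (lam x) = x) : rhoLam K X lam hlam 1 = 1 := by
  ext x y
  simp [rhoLam_apply, (Function.Involutive.injective hinvo).eq_iff, eq_comm]

theorem rhoLam_mul (hinvo : ∀ x : X, lam (lam x) = x) (f g : IncidenceAlgebra K X) :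
    rhoLam K X lam hlam (f * g) = rhoLam K X lam hlam g * rhoLam K X lam hlam f := by
  ext x y
  simp only [rhoLam_apply, IncidenceAlgebra.mul_apply]
  refine Finset.sum_nbij' lam lam ?_ ?_ (fun _ _ => hinvo _) (fun _ _ => hinvo _) ?_
  · intro z hz
    rw [Finset.mem_Icc] at hz ⊢
    rw [hlam x, hlam _ y, hinvo]
    exact hz.symm
  · intro z hz
    rw [Finset.mem_Icc] at hz ⊢
    rw [← hlam, ← hlam]
    exact hz.symm
  · intro z _
    rw [hinvo, mul_comm]

end

section

variable {K X}

theorem TrivSqZeroExt.snd_mul_incidenceAlgebra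
    (d e : TrivSqZeroExt (IncidenceAlgebra K X) (IncidenceAlgebra K X)) :
    (d * e).snd = d.fst * e.snd + d.snd * e.fst := rfl

variable {lam : X → X} (hlam : ∀ x y : X, x ≤ y ↔ lam y ≤ lam x)

theorem fst_rhoTilde_kTilde (k : K)
    (d : TrivSqZeroExt (IncidenceAlgebra K X) (IncidenceAlgebra K X)) :
    (rhoTilde K X lam hlam (kTilde K X k d)).fst = rhoLam K X lam hlam d.fst := by
  simp [rhoTilde, kTilde]

theorem snd_rhoTilde_kTilde (k : K)
    (d : TrivSqZeroExt (IncidenceAlgebra K X) (IncidenceAlgebra K X)) :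
    (rhoTilde K X lam hlam (kTilde K X k d)).snd = k • rhoLam K X lam hlam d.snd := by
  simp [rhoTilde, kTilde, rhoLam_smul]

theorem rhoTilde_kTilde_add (k : K)
    (d e : TrivSqZeroExt (IncidenceAlgebra K X) (IncidenceAlgebra K X)) :
    rhoTilde K X lam hlam (kTilde K X k (d + e)) =
      rhoTilde K X lam hlam (kTilde K X k d) + rhoTilde K X lam hlam (kTilde K X k e) := by
  ext1 <;> simp [fst_rhoTilde_kTilde, snd_rhoTilde_kTilde, rhoLam_add]

theorem rhoTilde_kTilde_mul (hinvo : ∀ x : X, lam (lam x) = x) (k : K)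
    (d e : TrivSqZeroExt (IncidenceAlgebra K X) (IncidenceAlgebra K X)) :
    rhoTilde K X lam hlam (kTilde K X k (d * e)) =
      rhoTilde K X lam hlam (kTilde K X k e) * rhoTilde K X lam hlam (kTilde K X k d) := by
  ext1
  · simp [fst_rhoTilde_kTilde, rhoLam_mul hlam hinvo]
  · simp only [snd_mul_incidenceAlgebra, fst_rhoTilde_kTilde, snd_rhoTilde_kTilde, rhoLam_add,
      rhoLam_mul hlam hinvo, smul_add, mul_smul_comm, smul_mul_assoc]
    exact add_comm _ _

theorem rhoTilde_kTilde_one (hinvo : ∀ x : X, lam (lam x) = x) (k : K) :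
    rhoTilde K X lam hlam (kTilde K X k 1) = 1 := by
  ext1
  · simp [fst_rhoTilde_kTilde, rhoLam_one hlam hinvo]
  · simp [snd_rhoTilde_kTilde, rhoLam_zero]

theorem rhoTilde_kTilde_self (hinvo : ∀ x : X, lam (lam x) = x) {k : K} (hk : k * k = 1)
    (d : TrivSqZeroExt (IncidenceAlgebra K X) (IncidenceAlgebra K X)) :
    rhoTilde K X lam hlam (kTilde K X k (rhoTilde K X lam hlam (kTilde K X k d))) = d := by
  ext1
  · simp [fst_rhoTilde_kTilde, rhoLam_rhoLam hlam hinvo]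
  · rw [snd_rhoTilde_kTilde, snd_rhoTilde_kTilde, rhoLam_smul, rhoLam_rhoLam hlam hinvo,
      smul_smul, hk, one_smul]

variable (K X) in
/-- The element `(p · δ, q · δ)` of `D(X,K)`. -/
def scalarPair (p q : K) : TrivSqZeroExt (IncidenceAlgebra K X) (IncidenceAlgebra K X) :=
  inl (p • 1) + inr (q • 1)

theorem fst_scalarPair (p q : K) : (scalarPair K X p q).fst = p • 1 := by simp [scalarPair]

theorem snd_scalarPair (p q : K) : (scalarPair K X p q).snd = q • 1 := by simp [scalarPair]

theorem scalarPair_mul (p q p' q' : K) :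
    scalarPair K X p q * scalarPair K X p' q' = scalarPair K X (p * p') (p * q' + q * p') := by
  ext1
  · simp [fst_scalarPair, smul_smul, mul_comm]
  · simp [fst_scalarPair, snd_scalarPair, smul_smul, add_smul, mul_comm]

theorem scalarPair_one_zero : scalarPair K X 1 0 = 1 := by simp [scalarPair]

theorem scalarPair_mul_comm (p q : K)
    (d : TrivSqZeroExt (IncidenceAlgebra K X) (IncidenceAlgebra K X)) :
    scalarPair K X p q * d = d * scalarPair K X p q := by
  ext1
  · simp [fst_scalarPair]
  · simp [fst_scalarPair, snd_scalarPair, add_comm]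

theorem scalarPair_inj [Nonempty X] {p q p' q' : K} :
    scalarPair K X p q = scalarPair K X p' q' ↔ p = p' ∧ q = q' := by
  refine ⟨fun h => ?_, fun h => by rw [h.1, h.2]⟩
  obtain ⟨x⟩ := ‹Nonempty X›
  constructor
  · simpa [fst_scalarPair] using congrArg (fun d => d.fst x x) h
  · simpa [snd_scalarPair] using congrArg (fun d => d.snd x x) h

theorem rhoTilde_kTilde_scalarPair (hinvo : ∀ x : X, lam (lam x) = x) (k p q : K) :
    rhoTilde K X lam hlam (kTilde K X k (scalarPair K X p q)) = scalarPair K X p (k * q) := by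
  ext1
  · simp [fst_rhoTilde_kTilde, fst_scalarPair, rhoLam_smul, rhoLam_one hlam hinvo]
  · simp [snd_rhoTilde_kTilde, snd_scalarPair, rhoLam_smul, rhoLam_one hlam hinvo, smul_smul]

theorem TrivSqZeroExt.exists_eq_scalarPair_of_central [Nonempty X] (hconn : PosetConnected X)
    (c : TrivSqZeroExt (IncidenceAlgebra K X) (IncidenceAlgebra K X))
    (hc : ∀ d, c * d = d * c) : ∃ a b : K, c = scalarPair K X a b := by
  obtain ⟨a, ha⟩ := IncidenceAlgebra.exists_smul_one_of_central hconn c.fst fun g => by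
    simpa using congrArg fst (hc (inl g))
  obtain ⟨b, hb⟩ := IncidenceAlgebra.exists_smul_one_of_central hconn c.snd fun g => by
    simpa [snd_mul_incidenceAlgebra] using congrArg snd (hc (inl g))
  exact ⟨a, b, by ext1 <;> simp [ha, hb, scalarPair]⟩

variable (K) in
/-- The diagonal idempotent of `I(X,K)` supported on `X₁`. -/
noncomputable def diagIndicator (X₁ : Set X) : IncidenceAlgebra K X :=
  open Classical in
  ⟨fun x y => if x = y then (if x ∈ X₁ then (1 : K) else 0) else 0,
    fun _ _ hab => if_neg fun h => hab h.le⟩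

open Classical in
theorem diagIndicator_apply (X₁ : Set X) (x y : X) :
    diagIndicator K X₁ x y = if x = y then (if x ∈ X₁ then (1 : K) else 0) else 0 := rfl

open Classical in
theorem diagIndicator_mul_apply (X₁ : Set X) (f : IncidenceAlgebra K X) (x y : X) :
    (diagIndicator K X₁ * f) x y = if x ∈ X₁ then f x y else 0 := by
  by_cases hxy : x ≤ y
  · simp [IncidenceAlgebra.mul_apply, diagIndicator_apply, hxy]
  · simp [IncidenceAlgebra.apply_eq_zero_of_not_le hxy]

open Classical in
theorem mul_diagIndicator_apply (X₁ : Set X) (f : IncidenceAlgebra K X) (x y : X) :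
    (f * diagIndicator K X₁) x y = if y ∈ X₁ then f x y else 0 := by
  by_cases hxy : x ≤ y
  · simp +contextual [IncidenceAlgebra.mul_apply, diagIndicator_apply, hxy]
  · simp [IncidenceAlgebra.apply_eq_zero_of_not_le hxy]

theorem diagIndicator_mul_self (X₁ : Set X) :
    diagIndicator K X₁ * diagIndicator K X₁ = diagIndicator K X₁ := by
  ext x y
  rw [diagIndicator_mul_apply, diagIndicator_apply]
  split_ifs <;> rfl

theorem diagIndicator_mul_mul_diagIndicator {X₁ : Set X} (hX₁ : ∀ x ∈ X₁, ∀ y, y ≤ x → y ∈ X₁)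
    (f : IncidenceAlgebra K X) :
    diagIndicator K X₁ * (f * diagIndicator K X₁) = f * diagIndicator K X₁ := by
  ext x y hxy
  rw [diagIndicator_mul_apply, mul_diagIndicator_apply]
  split_ifs with hx hy hy
  · rfl
  · rfl
  · exact absurd (hX₁ y hy x hxy) hx
  · rfl

theorem rhoLam_diagIndicator (hinvo : ∀ x : X, lam (lam x) = x) {X₁ : Set X}
    (hX₁ : ∀ x, lam x ∈ X₁ ↔ x ∉ X₁) :
    rhoLam K X lam hlam (diagIndicator K X₁) = 1 - diagIndicator K X₁ := by
  ext x y
  rw [rhoLam_apply, diagIndicator_apply, IncidenceAlgebra.sub_apply, diagIndicator_apply,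
    IncidenceAlgebra.one_apply]
  rcases eq_or_ne x y with rfl | hne
  · by_cases hx : x ∈ X₁ <;> simp [hx, hX₁]
  · simp [hne, hne.symm, (Function.Involutive.injective hinvo).eq_iff]

theorem wElem_eq (X₁ : Set X) :
    wElem K X X₁ = diagIndicator K X₁ - (1 - diagIndicator K X₁) := by
  ext x y
  change (if x = y then _ else _ : K) = _
  rw [IncidenceAlgebra.sub_apply, IncidenceAlgebra.sub_apply, diagIndicator_apply,
    IncidenceAlgebra.one_apply]
  split_ifs <;> simp

theorem wElem_mul_self (X₁ : Set X) : wElem K X X₁ * wElem K X X₁ = 1 := by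
  simp only [wElem_eq, mul_sub, sub_mul, mul_one, one_mul, diagIndicator_mul_self]
  abel

theorem sigmaTilde_eq (X₁ : Set X)
    (d : TrivSqZeroExt (IncidenceAlgebra K X) (IncidenceAlgebra K X)) :
    sigmaTilde K X X₁ lam hlam d =
      inl (wElem K X X₁) * rhoTilde K X lam hlam d * inl (wElem K X X₁) := by
  have h : Ring.inverse (wElem K X X₁) = wElem K X X₁ :=
    Ring.inverse_unit ⟨_, _, wElem_mul_self X₁, wElem_mul_self X₁⟩
  ext1
  · simp [sigmaTilde, sigmaLam, rhoTilde, h]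
  · simp [sigmaTilde, sigmaLam, rhoTilde, h]

end

/-- Assume `char K ≠ 2` and `X` is a connected locally finite poset satisfying conditions
(M) and (D).  Let `λ` be a fixed-point-free involution on `X`, with a partition
`X = X₁ ∪ X₂` as described.  Then every involution `Φ = Ψ_θ ∘ ρ̃_λ ∘ k̃δ` on `D(X,K)`,
`k ∈ {-1,1}`, satisfies `Φ ∘ Ψ = Ψ ∘ (ρ̃_λ ∘ k̃δ)` or `Φ ∘ Ψ = Ψ ∘ (σ̃_λ ∘ k̃δ)` for
some inner automorphism `Ψ` of `D(X,K)`. -/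
theorem classification_of_involutions_no_fixed_points
    (K X : Type*) [Field K] [PartialOrder X] [LocallyFiniteOrder X] [DecidableEq X]
    (hchar : (2 : K) ≠ 0)
    (hconn : PosetConnected X) (hM : CondM K X) (hD : CondD K X)
    (lam : X → X)
    (hlam : ∀ x y : X, x ≤ y ↔ lam y ≤ lam x)
    (hlaminvo : ∀ x : X, lam (lam x) = x)
    (hnofix : ∀ x : X, lam x ≠ x)
    (X₁ X₂ : Set X)
    (hdisj : Disjoint X₁ X₂) (hunion : X₁ ∪ X₂ = Set.univ)
    (hlam12 : ∀ x ∈ X₁, lam x ∈ X₂) (hlam21 : ∀ x ∈ X₂, lam x ∈ X₁)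
    (hdown : ∀ x ∈ X₁, ∀ y : X, y ≤ x → y ∈ X₁)
    (hup : ∀ x ∈ X₂, ∀ y : X, x ≤ y → y ∈ X₂)
    (Φ : TrivSqZeroExt (IncidenceAlgebra K X) (IncidenceAlgebra K X) →
         TrivSqZeroExt (IncidenceAlgebra K X) (IncidenceAlgebra K X))
    (θ : (TrivSqZeroExt (IncidenceAlgebra K X) (IncidenceAlgebra K X))ˣ)
    (k : K) (hk : k = 1 ∨ k = -1)
    (hΦ : ∀ d, Φ d = ↑θ * rhoTilde K X lam hlam (kTilde K X k d) * ↑θ⁻¹)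
    (hΦinvo : ∀ d, Φ (Φ d) = d) :
    ∃ γ : (TrivSqZeroExt (IncidenceAlgebra K X) (IncidenceAlgebra K X))ˣ,
      (∀ d, Φ (↑γ * d * ↑γ⁻¹) = ↑γ * rhoTilde K X lam hlam (kTilde K X k d) * ↑γ⁻¹) ∨
      (∀ d, Φ (↑γ * d * ↑γ⁻¹) = ↑γ * sigmaTilde K X X₁ lam hlam (kTilde K X k d) * ↑γ⁻¹) := by
  rcases isEmpty_or_nonempty X with hX | hX
  · have : Subsingleton (IncidenceAlgebra K X) := ⟨fun f g => by ext x; exact hX.elim x⟩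
    exact ⟨1, .inl fun d => by ext1 <;> exact Subsingleton.elim _ _⟩
  have hkk : k * k = 1 := by rcases hk with rfl | rfl <;> simp
  set R := fun d => rhoTilde K X lam hlam (kTilde K X k d) with hR
  have hadd : ∀ x y, R (x + y) = R x + R y := rhoTilde_kTilde_add hlam k
  have hmul : ∀ x y, R (x * y) = R y * R x := rhoTilde_kTilde_mul hlam hlaminvo k
  have hone : R 1 = 1 := rhoTilde_kTilde_one hlam hlaminvo k
  have hΦR (d) : Φ d = θ * R d * ↑θ⁻¹ := hΦ d
  obtain ⟨c, hc, hθc, hcc⟩ := central_of_involution R hmul hone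
    (rhoTilde_kTilde_self hlam hlaminvo hkk) θ fun d => by rw [← hΦR, ← hΦR, hΦinvo]
  obtain ⟨a, b, rfl⟩ := exists_eq_scalarPair_of_central hconn c hc
  have hRs (p q : K) : R (scalarPair K X p q) = scalarPair K X p (k * q) :=
    rhoTilde_kTilde_scalarPair hlam hlaminvo k p q
  rw [hRs, scalarPair_mul, ← scalarPair_one_zero, scalarPair_inj] at hcc
  obtain ⟨haa, hab⟩ := hcc
  let z : (TrivSqZeroExt (IncidenceAlgebra K X) (IncidenceAlgebra K X))ˣ :=
    ⟨scalarPair K X 1 (-(a * b) / 2), scalarPair K X 1 (a * b / 2),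
      by rw [scalarPair_mul, ← scalarPair_one_zero, scalarPair_inj]; constructor <;> ring,
      by rw [scalarPair_mul, ← scalarPair_one_zero, scalarPair_inj]; constructor <;> ring⟩
  have hz : (z : TrivSqZeroExt (IncidenceAlgebra K X) (IncidenceAlgebra K X)) =
    scalarPair K X 1 (-(a * b) / 2) := rfl
  have hcz : scalarPair K X a b * z = scalarPair K X a 0 * R z := by
    rw [hz, hRs, scalarPair_mul, scalarPair_mul, scalarPair_inj]
    refine ⟨rfl, ?_⟩
    have h2 : (2 : K) * 2⁻¹ = 1 := mul_inv_cancel₀ hchar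
    linear_combination a / 2 * hab - b * haa - a ^ 2 * b * h2
  have hθz : R (z * θ) = scalarPair K X a 0 * (z * θ) := by
    have h : z * θ = scalarPair K X a 0 * R (z * θ) := by
      have hz' : R z * R θ = R θ * R z := by rw [hz, hRs, scalarPair_mul_comm]
      rw [hmul, ← hz', ← mul_assoc, ← hcz, hc, mul_assoc, ← hθc]
    conv_rhs => rw [h]
    rw [← mul_assoc, scalarPair_mul, haa]
    simp [scalarPair_one_zero]
  have hX₁ (x : X) : lam x ∈ X₁ ↔ x ∉ X₁ := by
    have h2 (x) : x ∈ X₂ ↔ x ∉ X₁ :=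
      ⟨fun h h' => Set.disjoint_left.1 hdisj h' h, fun h =>
        ((hunion ▸ Set.mem_univ x : x ∈ X₁ ∪ X₂).resolve_left h)⟩
    refine ⟨fun h h' => (h2 _).1 (hlam12 x h') h, fun h => hlam21 x ((h2 x).2 h)⟩
  have ha : scalarPair K X a 0 = 1 ∨ scalarPair K X a 0 = -1 := by
    rcases mul_self_eq_one_iff.1 haa with rfl | rfl
    · exact .inl scalarPair_one_zero
    · exact .inr (by simp [scalarPair])
  have hη : scalarPair K X (1 / 2) 0 + scalarPair K X (1 / 2) 0 = 1 := by
    have : NeZero (2 : K) := ⟨hchar⟩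
    ext1
    · rw [fst_add, fst_scalarPair, ← add_smul, add_halves, one_smul, fst_one]
    · simp [snd_scalarPair]
  have he : (inl (diagIndicator K X₁) : TrivSqZeroExt (IncidenceAlgebra K X)
      (IncidenceAlgebra K X)) * inl (diagIndicator K X₁) = inl (diagIndicator K X₁) := by
    rw [← inl_mul, diagIndicator_mul_self]
  have hRe : R (inl (diagIndicator K X₁)) = 1 - inl (diagIndicator K X₁) := by
    ext1
    · simp [hR, fst_rhoTilde_kTilde, rhoLam_diagIndicator hlam hlaminvo hX₁]
    · simp [hR, snd_rhoTilde_kTilde, rhoLam_zero]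
  have hcorner (x : TrivSqZeroExt (IncidenceAlgebra K X) (IncidenceAlgebra K X)) :
      inl (diagIndicator K X₁) * (x * inl (diagIndicator K X₁)) =
        x * inl (diagIndicator K X₁) := by
    ext1
    · simp [diagIndicator_mul_mul_diagIndicator hdown]
    · simp [diagIndicator_mul_mul_diagIndicator hdown]
  obtain ⟨g, hg⟩ := exists_unit_conj_involution R hadd hmul hone he hRe hcorner hη ha θ z
    (scalarPair_mul_comm _ _) hθz
  refine ⟨g, ?_⟩
  rcases ha with ha | ha
  · left
    intro d
    rw [hΦR, hg, ha]
    simp [hR]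
  · right
    intro d
    rw [hΦR, hg, ha, neg_one_mul, ← sub_eq_add_neg, sigmaTilde_eq, wElem_eq, inl_sub, inl_sub,
      inl_one]
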